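/- arXiv:2511.17984 — 2 statements merged into one kernel-verified Lean document; each statement's English description precedes it below -/
import Mathlib

section
/- Let V and W be complex Hilbert spaces and let a : V × W → ℂ be a bounded sesquilinear form (linear in the first argument, conjugate-linear in the second). Then the following are equivalent: (i) for every continuous antilinear functional ℓ on W, the variational problem 'find v ∈ V such that a(v,w) = ℓ(w) for all w ∈ W' has a unique solution; (ii) a is T-coercive, i.e., there exist a bounded linear bijective operator T : V → W and a constant α > 0 such that |a(v, Tv)| ≥ α ‖v‖²_V for all v ∈ V. -/
theorem riesz_anti {W : Type*} [NormedAddCommGroup W] [InnerProductSpace ℂ W] [CompleteSpace W] :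
    Function.Bijective ((innerSL ℂ : W →L⋆[ℂ] W →L[ℂ] ℂ).flip : W →L[ℂ] W →L⋆[ℂ] ℂ) := by
  constructor
  · intro x y h
    refine ext_inner_left ℂ fun w => ?_
    simpa using congrArg (fun f : W →L⋆[ℂ] ℂ => f w) h
  · intro l
    let m : W →L[ℂ] ℂ := ((starL ℂ : ℂ ≃L⋆[ℂ] ℂ) : ℂ →L⋆[ℂ] ℂ).comp l
    refine ⟨(InnerProductSpace.toDual ℂ W).symm m, ?_⟩
    ext w
    have h : inner ℂ ((InnerProductSpace.toDual ℂ W).symm m) w = m w :=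
      InnerProductSpace.toDual_symm_apply
    have h2 : m w = star (l w) := rfl
    rw [ContinuousLinearMap.flip_apply, innerSL_apply_apply, ← inner_conj_symm, h, h2]
    simp

/-- **Well-posedness ⇔ T-coercivity.**
Let `V`, `W` be complex Hilbert spaces and `a : V × W → ℂ` a bounded sesquilinear form
(linear in the first argument, conjugate-linear in the second).  The variational problem
`a(v, w) = ℓ(w)` for all `w` has a unique solution for every continuous antilinear
functional `ℓ` on `W` if and only if `a` is T-coercive, i.e. there exist a bounded linear
bijective `T : V → W` and `α > 0` with `|a(v, T v)| ≥ α ‖v‖²` for all `v`. -/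
theorem wellposed_iff_T_coercive
    {V W : Type*} [NormedAddCommGroup V] [InnerProductSpace ℂ V] [CompleteSpace V]
    [NormedAddCommGroup W] [InnerProductSpace ℂ W] [CompleteSpace W]
    (a : V →L[ℂ] W →L⋆[ℂ] ℂ) :
    (∀ ℓ : W →L⋆[ℂ] ℂ, ∃! v : V, ∀ w : W, a v w = ℓ w) ↔
      (∃ T : V →L[ℂ] W, Function.Bijective T ∧
        ∃ α : ℝ, 0 < α ∧ ∀ v : V, α * ‖v‖ ^ 2 ≤ ‖a v (T v)‖) := by
  obtain ⟨A, hA⟩ : ∃ A : V →L[ℂ] W, ∀ v w, a v w = inner ℂ w (A v) := by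
    let J := ContinuousLinearEquiv.ofBijective
      ((innerSL ℂ : W →L⋆[ℂ] W →L[ℂ] ℂ).flip : W →L[ℂ] W →L⋆[ℂ] ℂ)
      (LinearMap.ker_eq_bot.2 riesz_anti.1) (LinearMap.range_eq_top.2 riesz_anti.2)
    refine ⟨(J.symm : (W →L⋆[ℂ] ℂ) →L[ℂ] W).comp a, fun v w => ?_⟩
    have h : J (J.symm (a v)) = a v := J.apply_symm_apply _
    have h2 : J (J.symm (a v)) w = inner ℂ w (J.symm (a v)) := rfl
    rw [h] at h2
    exact h2
  have key : (∀ ℓ : W →L⋆[ℂ] ℂ, ∃! v : V, ∀ w : W, a v w = ℓ w) ↔ Function.Bijective A := by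
    rw [Function.bijective_iff_existsUnique, riesz_anti.2.forall]
    refine forall_congr' fun u => existsUnique_congr fun v => ?_
    simp only [hA, ContinuousLinearMap.flip_apply, innerSL_apply_apply]
    exact ⟨fun h => ext_inner_left ℂ h, fun h w => by rw [h]⟩
  rw [key]
  constructor
  · intro hb
    refine ⟨A, hb, ?_⟩
    let E := ContinuousLinearEquiv.ofBijective A
      (LinearMap.ker_eq_bot.2 hb.1) (LinearMap.range_eq_top.2 hb.2)
    let S : W →L[ℂ] V := E.symm
    have hS : ∀ v, ‖v‖ ≤ (‖S‖ + 1) * ‖A v‖ := fun v => by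
      have h1 : S (A v) = v := E.symm_apply_apply v
      have h2 := S.le_opNorm (A v)
      rw [h1] at h2
      nlinarith [norm_nonneg (A v)]
    have hp : 0 < ‖S‖ + 1 := by positivity
    refine ⟨((‖S‖ + 1) ^ 2)⁻¹, by positivity, fun v => ?_⟩
    rw [hA, inner_self_eq_norm_sq_to_K, inv_mul_le_iff₀ (by positivity)]
    have := pow_le_pow_left₀ (norm_nonneg v) (hS v) 2
    rw [mul_pow] at this
    simpa using this
  · rintro ⟨T, hT, α, hα, h⟩
    have hlow : ∀ v, ‖v‖ ≤ (‖T‖ / α) * ‖A v‖ := fun v => by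
      rcases (norm_nonneg v).eq_or_lt with h0 | h0
      · rw [← h0]; positivity
      have h1 := h v
      rw [hA] at h1
      have h2 := norm_inner_le_norm (𝕜 := ℂ) (T v) (A v)
      have h3 := mul_le_mul_of_nonneg_right (T.le_opNorm v) (norm_nonneg (A v))
      rw [div_mul_eq_mul_div, le_div_iff₀ hα]
      refine le_of_mul_le_mul_right ?_ h0
      nlinarith
    have hanti : AntilipschitzWith (Real.toNNReal (‖T‖ / α)) A := by
      refine AddMonoidHomClass.antilipschitz_of_bound A fun v => ?_
      rw [Real.coe_toNNReal _ (by positivity)]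
      exact hlow v
    refine ⟨hanti.injective, ?_⟩
    have hcl : IsClosed (Set.range A) := hanti.isClosed_range A.uniformContinuous
    have hc : IsClosed ((LinearMap.range (A : V →ₗ[ℂ] W) : Submodule ℂ W) : Set W) := by
      rw [LinearMap.coe_range]; exact hcl
    have : CompleteSpace (LinearMap.range (A : V →ₗ[ℂ] W)) := hc.completeSpace_coe
    have htop : LinearMap.range (A : V →ₗ[ℂ] W) = ⊤ := by
      rw [← Submodule.orthogonal_eq_bot_iff, Submodule.eq_bot_iff]
      intro w hw
      obtain ⟨v, rfl⟩ := hT.2 w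
      have h0 : inner ℂ (T v) (A v) = 0 :=
        (Submodule.mem_orthogonal' _ _).1 hw (A v) ⟨v, rfl⟩
      have h1 := h v
      rw [hA, h0, norm_zero] at h1
      have h2 : ‖v‖ = 0 := by
        by_contra hne
        have : 0 < ‖v‖ := lt_of_le_of_ne (norm_nonneg v) (Ne.symm hne)
        have : 0 < α * ‖v‖ ^ 2 := by positivity
        linarith
      rw [norm_eq_zero.1 h2, map_zero]
    exact LinearMap.range_eq_top.1 htop
end

section
/- Let H be a separable complex Hilbert space with orthonormal Hilbert basis (ψ_n)_{n∈ℕ}, let (κ_n)_{n∈ℕ} be positive reals with κ_n → +∞, and let ω > 0 satisfy ω² ≠ κ_n for all n. Define the bounded sesquilinear form a(u,v) := Σ_{n} ((κ_n − ω²)/(1 + κ_n)) ⟨u, ψ_n⟩ ⟨ψ_n, v⟩, let P be the orthogonal projection onto the (finite-dimensional) subspace span{ψ_n : κ_n < ω²}, and let T := I − 2P. Then for every v ∈ H, a(v, T v) is real and a(v, T v) ≥ γ_min ‖v‖², where γ_min := inf_{n} |ω² − κ_n|/(1 + κ_n) > 0. In particular, a is T-coercive. -/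
open Filter
open scoped InnerProductSpace

/-- **`𝕋`-coercivity of the diagonalized elasticity form.**
Let `H` be a separable complex Hilbert space with orthonormal Hilbert basis `(ψ_n)`, let
`(κ_n)` be positive reals with `κ_n → +∞`, and let `ω > 0` with `ω² ≠ κ_n` for all `n`.
Let `a(u,v) := Σ_n ((κ_n − ω²)/(1 + κ_n)) ⟨u, ψ_n⟩ ⟨ψ_n, v⟩` (the paper's inner product,
linear in the first slot, is `⟨x, y⟩ = ⟪y, x⟫_ℂ` in Mathlib's convention), let `P` be the
orthogonal projection onto `span{ψ_n : κ_n < ω²}` and `T := I − 2P`.  Then for every `v`,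
`a(v, T v)` is real and `a(v, T v) ≥ γ_min ‖v‖²` where
`γ_min := ⨅ n, |ω² − κ_n|/(1 + κ_n) > 0`; in particular `T` is bijective and `a` is
`T`-coercive. -/
theorem elasticity_form_T_coercive
    {H : Type*} [NormedAddCommGroup H] [InnerProductSpace ℂ H] [CompleteSpace H]
    [TopologicalSpace.SeparableSpace H]
    (ψ : HilbertBasis ℕ ℂ H) (κ : ℕ → ℝ) (hκpos : ∀ n, 0 < κ n)
    (hκtop : Tendsto κ atTop atTop)
    (ω : ℝ) (hωpos : 0 < ω) (hω : ∀ n, ω ^ 2 ≠ κ n)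
    (a : H → H → ℂ)
    (ha : ∀ u v : H, a u v =
      ∑' n : ℕ, (((κ n - ω ^ 2) / (1 + κ n) : ℝ) : ℂ) * ⟪(ψ n : H), u⟫_ℂ * ⟪v, (ψ n : H)⟫_ℂ)
    (F : Submodule ℂ H) [CompleteSpace F]
    (hF : F = Submodule.span ℂ {x : H | ∃ n, κ n < ω ^ 2 ∧ x = ψ n})
    (T : H →L[ℂ] H)
    (hT : T = ContinuousLinearMap.id ℂ H - 2 • (F.subtypeL.comp (Submodule.orthogonalProjectionOnto F)))
    (γmin : ℝ) (hγ : γmin = ⨅ n : ℕ, |ω ^ 2 - κ n| / (1 + κ n)) :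
    0 < γmin ∧ Function.Bijective T ∧
      ∀ v : H, (a v (T v)).im = 0 ∧ γmin * ‖v‖ ^ 2 ≤ (a v (T v)).re ∧
        γmin * ‖v‖ ^ 2 ≤ ‖a v (T v)‖ := by
  have hg0 : ∀ n, 0 < |ω ^ 2 - κ n| / (1 + κ n) := fun n =>
    div_pos (abs_pos.mpr (sub_ne_zero.mpr (hω n))) (by linarith [hκpos n])
  have hbdd : BddBelow (Set.range fun n : ℕ => |ω ^ 2 - κ n| / (1 + κ n)) :=
    ⟨0, by rintro _ ⟨n, rfl⟩; exact (hg0 n).le⟩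
  have hle : ∀ n, γmin ≤ |ω ^ 2 - κ n| / (1 + κ n) := fun n => by
    rw [hγ]; exact ciInf_le hbdd n
  have hγpos : 0 < γmin := by
    obtain ⟨N, hN⟩ := eventually_atTop.mp (hκtop.eventually_ge_atTop (2 * ω ^ 2 + 1))
    obtain ⟨m, -, hm⟩ := Finset.exists_min_image (Finset.range (N + 1))
      (fun n => |ω ^ 2 - κ n| / (1 + κ n)) ⟨0, by simp⟩
    have h1 : min (1 / 4) (|ω ^ 2 - κ m| / (1 + κ m)) ≤ γmin := by
      rw [hγ]
      refine le_ciInf fun n => ?_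
      by_cases hn : n < N + 1
      · exact (min_le_right _ _).trans (hm n (Finset.mem_range.mpr hn))
      · refine (min_le_left _ _).trans ?_
        have h2 := hN n (by omega)
        rw [le_div_iff₀ (by linarith [hκpos n])]
        have := neg_abs_le (ω ^ 2 - κ n)
        nlinarith
    exact lt_of_lt_of_le (lt_min (by norm_num) (hg0 m)) h1
  have hTv : ∀ v, T v = v - (2 : ℂ) • (F.orthogonalProjectionOnto v : H) := fun v => by
    rw [hT]; simp [two_smul]
  have hinner : ∀ (v : H) n, ⟪T v, (ψ n : H)⟫_ℂ =
      (if κ n < ω ^ 2 then -1 else 1) * ⟪v, (ψ n : H)⟫_ℂ := by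
    intro v n
    rw [hTv, inner_sub_left, inner_smul_left]
    split_ifs with h
    · have hm : (ψ n : H) ∈ F := by
        rw [hF]; exact Submodule.subset_span ⟨n, h, rfl⟩
      have e := Submodule.inner_orthogonalProjectionOnto_eq_of_mem_left (⟨ψ n, hm⟩ : F) v
      have e2 : ⟪(F.orthogonalProjectionOnto v : H), (ψ n : H)⟫_ℂ = ⟪v, (ψ n : H)⟫_ℂ := by
        rw [← inner_conj_symm, ← inner_conj_symm v]
        exact congrArg _ e
      rw [e2, show (starRingEnd ℂ) 2 = 2 from Complex.conj_ofNat 2]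
      ring
    · have hm : (ψ n : H) ∈ Fᗮ := by
        rw [hF, Submodule.mem_orthogonal]
        intro u hu
        induction hu using Submodule.span_induction with
        | mem x hx =>
          obtain ⟨m, hm, rfl⟩ := hx
          exact ψ.orthonormal.2 (by rintro rfl; exact h hm)
        | zero => simp
        | add x y _ _ hx hy => rw [inner_add_left, hx, hy, add_zero]
        | smul c x _ hx => rw [inner_smul_left, hx, mul_zero]
      rw [(Submodule.mem_orthogonal _ _).mp hm _ (F.orthogonalProjectionOnto v).2]
      simp
  have hinv : Function.Involutive T := by
    intro v
    rw [hTv (T v), hTv v]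
    simp only [map_sub, map_smul, Submodule.orthogonalProjectionOnto_mem_subspace_eq_self,
      Submodule.coe_sub, Submodule.coe_smul]
    module
  refine ⟨hγpos, hinv.bijective, fun v => ?_⟩
  have hs : HasSum (fun n => ‖⟪(ψ n : H), v⟫_ℂ‖ ^ 2) (‖v‖ ^ 2) := by
    have h := ψ.hasSum_inner_mul_inner v v
    rw [inner_self_eq_norm_sq_to_K] at h
    rw [← Complex.hasSum_ofReal]
    have e : (fun n => (((‖⟪(ψ n : H), v⟫_ℂ‖ ^ 2 : ℝ)) : ℂ)) =
        fun n => ⟪v, (ψ n : H)⟫_ℂ * ⟪(ψ n : H), v⟫_ℂ := by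
      funext n
      rw [← inner_conj_symm v (ψ n : H), Complex.conj_mul']
      push_cast; rfl
    rw [e, Complex.ofReal_pow]
    exact h
  have hsum : Summable (fun n => |ω ^ 2 - κ n| / (1 + κ n) * ‖⟪(ψ n : H), v⟫_ℂ‖ ^ 2) := by
    refine Summable.of_nonneg_of_le (fun n => mul_nonneg (hg0 n).le (by positivity)) (fun n => ?_)
      (hs.summable.mul_left (1 + ω ^ 2))
    refine mul_le_mul_of_nonneg_right ?_ (by positivity)
    have := hκpos n
    rw [div_le_iff₀ (by linarith), abs_le]
    constructor <;> nlinarith [sq_nonneg ω, mul_nonneg (sq_nonneg ω) this.le]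
  have hval : a v (T v) =
      ((∑' n, |ω ^ 2 - κ n| / (1 + κ n) * ‖⟪(ψ n : H), v⟫_ℂ‖ ^ 2 : ℝ) : ℂ) := by
    rw [ha, Complex.ofReal_tsum]
    refine tsum_congr fun n => ?_
    have e : ⟪(ψ n : H), v⟫_ℂ * ⟪v, (ψ n : H)⟫_ℂ = ((‖⟪(ψ n : H), v⟫_ℂ‖ ^ 2 : ℝ) : ℂ) := by
      rw [← inner_conj_symm v (ψ n : H), Complex.mul_conj']
      simp
    rw [hinner, Complex.ofReal_mul, ← e]
    split_ifs with h
    · rw [abs_of_pos (by linarith)]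
      push_cast; ring
    · rw [abs_of_nonpos (by linarith)]
      push_cast; ring
  have hmain : γmin * ‖v‖ ^ 2 ≤ ∑' n, |ω ^ 2 - κ n| / (1 + κ n) * ‖⟪(ψ n : H), v⟫_ℂ‖ ^ 2 := by
    rw [← (hs.mul_left γmin).tsum_eq]
    exact (hs.mul_left γmin).summable.tsum_le_tsum
      (fun n => mul_le_mul_of_nonneg_right (hle n) (by positivity)) hsum
  rw [hval]
  refine ⟨Complex.ofReal_im _, by rwa [Complex.ofReal_re], ?_⟩
  rw [Complex.norm_real]
  exact hmain.trans (le_abs_self _)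
end
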